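/- arXiv:0809.2625 — 2 statements merged into one kernel-verified Lean document; each statement's English description precedes it below -/
import Mathlib

section
/- Let n ≥ 2 with design points t_i = i/n, i = 1,…,n, and let 𝓘_n be the collection of all nonempty sets of consecutive indices in {1,…,n}. Suppose Y_j(t_i) = f_j(t_i) + σ_j Z_j(t_i) for j = 1,2 with σ_j > 0, and suppose the noise realizations satisfy |Σ_{i∈I} Z_j(t_i)| ≤ √(|I| τ log n) for every I ∈ 𝓘_n and j = 1,2, where τ > 0. If there is a set I_0 ∈ 𝓘_n of m consecutive indices such that f_1(t_i) − f_2(t_i) > η for every i ∈ I_0, and η √m > 2(σ_1 + σ_2) √(τ log n), then there exists no function g with |Σ_{i∈I}(Y_j(t_i) − g(t_i))| ≤ σ_j √(|I| τ log n) for all I ∈ 𝓘_n and j = 1,2; that is, the intersection A_{1n} ∩ A_{2n} of the two approximation regions is empty. Equivalently, writing m = nδ_n the condition reads √(δ_n) η > 2(σ_1 + σ_2) √(τ log n / n). -/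
open Real Finset

/-- With design points `t_i = i/n`, `𝓘_n` all nonempty index intervals,
and noise realizations satisfying `|∑_{i∈I} Z_j(t_i)| ≤ √(|I| τ log n)` for all `I` and
`j = 1,2`: if `f_1 − f_2 > η` on an index interval `I₀` of `m` consecutive indices with
`η √m > 2(σ_1+σ_2)√(τ log n)`, then no joint approximating function exists, i.e. there is no
`g` with `|∑_{i∈I}(Y_j(t_i) − g(t_i))| ≤ σ_j √(|I| τ log n)` for all `I ∈ 𝓘_n` and `j = 1,2`:
the intersection `A_{1n} ∩ A_{2n}` is empty. -/
theorem stmt11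
    (n : ℕ) (hn : 2 ≤ n)
    (t : Fin n → ℝ) (ht : ∀ i : Fin n, t i = ((i : ℕ) + 1) / n)
    (f₁ f₂ : ℝ → ℝ) (σ₁ σ₂ τ : ℝ) (hσ₁ : 0 < σ₁) (hσ₂ : 0 < σ₂) (hτ : 0 < τ)
    (Z₁ Z₂ : Fin n → ℝ)
    (Y₁ Y₂ : Fin n → ℝ)
    (hY₁ : ∀ i, Y₁ i = f₁ (t i) + σ₁ * Z₁ i)
    (hY₂ : ∀ i, Y₂ i = f₂ (t i) + σ₂ * Z₂ i)
    (hZ₁ : ∀ a b : Fin n, a ≤ b →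
      |∑ i ∈ Finset.Icc a b, Z₁ i| ≤ Real.sqrt ((Finset.Icc a b).card * (τ * Real.log n)))
    (hZ₂ : ∀ a b : Fin n, a ≤ b →
      |∑ i ∈ Finset.Icc a b, Z₂ i| ≤ Real.sqrt ((Finset.Icc a b).card * (τ * Real.log n)))
    (a₀ b₀ : Fin n) (ha₀b₀ : a₀ ≤ b₀) (m : ℕ) (hm : m = (Finset.Icc a₀ b₀).card)
    (η : ℝ)
    (hsep : ∀ i ∈ Finset.Icc a₀ b₀, f₁ (t i) - f₂ (t i) > η)
    (hdetect : η * Real.sqrt m > 2 * (σ₁ + σ₂) * Real.sqrt (τ * Real.log n)) :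
    ¬ ∃ g : ℝ → ℝ, ∀ a b : Fin n, a ≤ b →
        |∑ i ∈ Finset.Icc a b, (Y₁ i - g (t i))|
          ≤ σ₁ * Real.sqrt ((Finset.Icc a b).card * (τ * Real.log n)) ∧
        |∑ i ∈ Finset.Icc a b, (Y₂ i - g (t i))|
          ≤ σ₂ * Real.sqrt ((Finset.Icc a b).card * (τ * Real.log n)) := by
  rintro ⟨g, hg⟩
  obtain ⟨h₁, h₂⟩ := hg a₀ b₀ ha₀b₀
  have hz₁ := hZ₁ a₀ b₀ ha₀b₀
  have hz₂ := hZ₂ a₀ b₀ ha₀b₀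
  have hsum : (m : ℝ) * η ≤ ∑ i ∈ Finset.Icc a₀ b₀, (f₁ (t i) - f₂ (t i)) := by
    rw [hm, ← nsmul_eq_mul]
    exact Finset.card_nsmul_le_sum _ _ _ fun i hi => (hsep i hi).le
  have hmpos : (0 : ℝ) < m := by
    rw [hm]
    exact_mod_cast Finset.card_pos.mpr (Finset.nonempty_Icc.mpr ha₀b₀)
  rw [← hm, Real.sqrt_mul hmpos.le] at h₁ h₂ hz₁ hz₂
  simp only [hY₁, hY₂, Finset.sum_sub_distrib, Finset.sum_add_distrib, ← Finset.mul_sum]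
    at h₁ h₂ hsum
  have hz₁' := mul_le_mul_of_nonneg_left (abs_le.mp hz₁).1 hσ₁.le
  have hz₂' := mul_le_mul_of_nonneg_left (abs_le.mp hz₂).2 hσ₂.le
  have hlarge := mul_lt_mul_of_pos_left hdetect (Real.sqrt_pos.mpr hmpos)
  have hmη : √(m : ℝ) * (η * √(m : ℝ)) = m * η := by
    rw [mul_left_comm, Real.mul_self_sqrt hmpos.le, mul_comm]
  linarith [(abs_le.mp h₁).2, (abs_le.mp h₂).1]
end

section
/- Let n ≥ 1 with design points t_i = i/n, i = 1,…,n, let 𝓘_n be the collection of all nonempty sets of consecutive indices in {1,…,n}, and let γ > 0. Suppose Y_j(t_i) = f_j(t_i) + σ_j Z_j(t_i) for j = 1,2 with σ_j > 0, and suppose the noise realizations satisfy |Σ_{i∈I} Z_j(t_i)| ≤ √|I| · √(2 log(n/|I|) + γ log(log(e^e n/|I|))) for every I ∈ 𝓘_n and j = 1,2. If there is a set I_0 ∈ 𝓘_n of m consecutive indices such that f_1(t_i) − f_2(t_i) > η for every i ∈ I_0, and η √(h(m/n)) > 2(σ_1 + σ_2)/√n where h(δ) = δ/(2 log(1/δ)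 + γ log(log(e^e/δ))), then there exists no function g with |Σ_{i∈I}(Y_j(t_i) − g(t_i))| ≤ σ_j √|I| · √(2 log(n/|I|) + γ log(log(e^e n/|I|))) for all I ∈ 𝓘_n and j = 1,2; that is, the intersection A*_{1n} ∩ A*_{2n} of the two approximation regions is empty. -/
open Real Finset

/-- With design points `t_i = i/n`, `𝓘_n` all nonempty index intervals,
and noise realizations satisfying the multiscale bounds
`|∑_{i∈I} Z_j(t_i)| ≤ √|I| √(2 log(n/|I|) + γ log(log(eᵉ n/|I|)))` for all `I` and `j = 1,2`:
if `f_1 − f_2 > η` on an index interval `I₀` of `m` consecutive indices and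
`η √(h(m/n)) > 2(σ_1+σ_2)/√n` with `h(δ) = δ/(2 log(1/δ) + γ log(log(eᵉ/δ)))`, then no joint
approximating function exists in the sense of the regions `A*`, i.e. `A*_{1n} ∩ A*_{2n} = ∅`. -/
theorem stmt13
    (n : ℕ) (hn : 1 ≤ n)
    (t : Fin n → ℝ) (ht : ∀ i : Fin n, t i = ((i : ℕ) + 1) / n)
    (f₁ f₂ : ℝ → ℝ) (σ₁ σ₂ γ : ℝ) (hσ₁ : 0 < σ₁) (hσ₂ : 0 < σ₂) (hγ : 0 < γ)
    (Z₁ Z₂ : Fin n → ℝ)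
    (Y₁ Y₂ : Fin n → ℝ)
    (hY₁ : ∀ i, Y₁ i = f₁ (t i) + σ₁ * Z₁ i)
    (hY₂ : ∀ i, Y₂ i = f₂ (t i) + σ₂ * Z₂ i)
    (hZ₁ : ∀ a b : Fin n, a ≤ b →
      |∑ i ∈ Finset.Icc a b, Z₁ i| ≤ Real.sqrt (Finset.Icc a b).card *
        Real.sqrt (2 * Real.log (n / (Finset.Icc a b).card) +
          γ * Real.log (Real.log (Real.exp (Real.exp 1) * n / (Finset.Icc a b).card))))
    (hZ₂ : ∀ a b : Fin n, a ≤ b →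
      |∑ i ∈ Finset.Icc a b, Z₂ i| ≤ Real.sqrt (Finset.Icc a b).card *
        Real.sqrt (2 * Real.log (n / (Finset.Icc a b).card) +
          γ * Real.log (Real.log (Real.exp (Real.exp 1) * n / (Finset.Icc a b).card))))
    (a₀ b₀ : Fin n) (ha₀b₀ : a₀ ≤ b₀) (m : ℕ) (hm : m = (Finset.Icc a₀ b₀).card)
    (η : ℝ)
    (hsep : ∀ i ∈ Finset.Icc a₀ b₀, f₁ (t i) - f₂ (t i) > η)
    (hdetect : η * Real.sqrt ((m / n : ℝ) /
        (2 * Real.log (1 / (m / n : ℝ)) +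
          γ * Real.log (Real.log (Real.exp (Real.exp 1) / (m / n : ℝ)))))
      > 2 * (σ₁ + σ₂) / Real.sqrt n) :
    ¬ ∃ g : ℝ → ℝ, ∀ a b : Fin n, a ≤ b →
        |∑ i ∈ Finset.Icc a b, (Y₁ i - g (t i))|
          ≤ σ₁ * (Real.sqrt (Finset.Icc a b).card *
            Real.sqrt (2 * Real.log (n / (Finset.Icc a b).card) +
              γ * Real.log (Real.log (Real.exp (Real.exp 1) * n / (Finset.Icc a b).card)))) ∧
        |∑ i ∈ Finset.Icc a b, (Y₂ i - g (t i))|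
          ≤ σ₂ * (Real.sqrt (Finset.Icc a b).card *
            Real.sqrt (2 * Real.log (n / (Finset.Icc a b).card) +
              γ * Real.log (Real.log (Real.exp (Real.exp 1) * n / (Finset.Icc a b).card)))) := by
  rintro ⟨g, hg⟩
  obtain ⟨hg₁, hg₂⟩ := hg a₀ b₀ ha₀b₀
  have hz₁ := hZ₁ a₀ b₀ ha₀b₀
  have hz₂ := hZ₂ a₀ b₀ ha₀b₀
  have hne : (Finset.Icc a₀ b₀).Nonempty := Finset.nonempty_Icc.2 ha₀b₀
  have hsum : (m : ℝ) * η < ∑ i ∈ Finset.Icc a₀ b₀, (f₁ (t i) - f₂ (t i)) := by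
    have h := Finset.sum_lt_sum_of_nonempty hne hsep
    rwa [Finset.sum_const, nsmul_eq_mul, ← hm] at h
  have hdecomp : ∑ i ∈ Finset.Icc a₀ b₀, (f₁ (t i) - f₂ (t i)) =
      ∑ i ∈ Finset.Icc a₀ b₀, (Y₁ i - g (t i)) - ∑ i ∈ Finset.Icc a₀ b₀, (Y₂ i - g (t i))
        - σ₁ * ∑ i ∈ Finset.Icc a₀ b₀, Z₁ i + σ₂ * ∑ i ∈ Finset.Icc a₀ b₀, Z₂ i := by
    simp only [Finset.mul_sum, ← Finset.sum_sub_distrib, ← Finset.sum_add_distrib]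
    exact Finset.sum_congr rfl fun i _ => by rw [hY₁, hY₂]; ring
  have hm0 : 0 < (m : ℝ) := by
    rw [hm]; exact_mod_cast hne.card_pos
  have hn0 : 0 < √(n : ℝ) := Real.sqrt_pos.2 (by exact_mod_cast hn)
  rw [one_div_div, div_div_eq_mul_div, Real.sqrt_div (by positivity),
    Real.sqrt_div (by positivity)] at hdetect
  rw [← hm] at hg₁ hg₂ hz₁ hz₂
  set L := √(2 * Real.log (n / m) + γ * Real.log (Real.log (Real.exp (Real.exp 1) * n / m)))
  have hL : 0 < L := by
    refine (Real.sqrt_nonneg _).lt_of_ne' fun h0 => ?_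
    have hpos : 0 < 2 * (σ₁ + σ₂) / √(n : ℝ) := by positivity
    have h0' : L = 0 := h0
    rw [h0', div_zero, mul_zero] at hdetect
    exact lt_asymm hpos hdetect
  have hdet : 2 * (σ₁ + σ₂) * L < η * √(m : ℝ) := by
    have h : η * (√(m : ℝ) / √(n : ℝ) / L) = η * √(m : ℝ) / L / √(n : ℝ) := by ring
    rw [h, gt_iff_lt, div_lt_div_iff_of_pos_right hn0, lt_div_iff₀ hL] at hdetect
    exact hdetect
  have hdet' : 2 * (σ₁ + σ₂) * (√(m : ℝ) * L) < m * η := by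
    calc 2 * (σ₁ + σ₂) * (√(m : ℝ) * L) = 2 * (σ₁ + σ₂) * L * √(m : ℝ) := by ring
      _ < η * √(m : ℝ) * √(m : ℝ) := mul_lt_mul_of_pos_right hdet (Real.sqrt_pos.2 hm0)
      _ = m * η := by rw [mul_assoc, Real.mul_self_sqrt hm0.le, mul_comm]
  have h₁ := mul_le_mul_of_nonneg_left (abs_le.1 hz₁).1 hσ₁.le
  have h₂ := mul_le_mul_of_nonneg_left (abs_le.1 hz₂).2 hσ₂.le
  linarith [(abs_le.1 hg₁).2, (abs_le.1 hg₂).1]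
end
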